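/- arXiv:2109.03106 — 5 statements merged into one kernel-verified Lean document; each statement's English description precedes it below -/
import Mathlib

section
/- Let F = (A, R) be a finite abstract argumentation framework and let a ∈ A. Then a is skeptically accepted with respect to preferred semantics (i.e., a belongs to every preferred extension of F) if and only if both of the following hold: (1) there is an admissible set S with a ∈ S; and (2) for every admissible set S with a ∈ S and every admissible set S' that attacks S, there is an admissible set S'' with S' ∪ {a} ⊆ S''. -/
/-- A set of arguments is conflict-free wrt. the attack relation `R`. -/
def ConflictFree {A : Type*} (R : A → A → Prop) (S : Set A) : Prop :=
  ∀ a ∈ S, ∀ b ∈ S, ¬ R a b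

/-- `S` defends the argument `b`: every attacker of `b` is attacked by some member of `S`. -/
def Defends {A : Type*} (R : A → A → Prop) (S : Set A) (b : A) : Prop :=
  ∀ a, R a b → ∃ c ∈ S, R c a

/-- A set is admissible if it is conflict-free and defends all of its elements. -/
def Admissible {A : Type*} (R : A → A → Prop) (S : Set A) : Prop :=
  ConflictFree R S ∧ ∀ a ∈ S, Defends R S a

/-- A preferred extension is a ⊆-maximal admissible set. -/
def Preferred {A : Type*} (R : A → A → Prop) (E : Set A) : Prop :=
  Admissible R E ∧ ∀ S, Admissible R S → E ⊆ S → S = E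

/-- `S'` attacks the set `S`: some member of `S'` attacks some member of `S`. -/
def SetAttacksSet {A : Type*} (R : A → A → Prop) (S' S : Set A) : Prop :=
  ∃ a ∈ S', ∃ b ∈ S, R a b

/-- Every admissible set of a finite framework is contained in a preferred extension. -/
theorem exists_preferred_superset {A : Type*} [Fintype A] (R : A → A → Prop) (S : Set A)
    (hS : Admissible R S) : ∃ E, Preferred R E ∧ S ⊆ E := by
  obtain ⟨E, hSE, hE⟩ := (Set.toFinite {T : Set A | Admissible R T}).exists_le_maximal hS
  exact ⟨E, ⟨hE.prop, fun T hT hET => Set.Subset.antisymm (hE.le_of_ge hT hET) hET⟩, hSE⟩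

/-- An argument `a` is skeptically accepted wrt. preferred semantics iff
(1) some admissible set contains `a`, and (2) for every admissible set `S` containing `a`
and every admissible set `S'` attacking `S`, there is an admissible set `S''`
containing `S' ∪ {a}`. -/
theorem skeptical_preferred_characterization {A : Type*} [Fintype A]
    (R : A → A → Prop) (a : A) :
    (∀ E : Set A, Preferred R E → a ∈ E) ↔
      ((∃ S : Set A, Admissible R S ∧ a ∈ S) ∧
        (∀ S : Set A, Admissible R S → a ∈ S →
          ∀ S' : Set A, Admissible R S' → SetAttacksSet R S' S →
            ∃ S'' : Set A, Admissible R S'' ∧ S' ∪ {a} ⊆ S'')) := by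
  constructor
  · intro h
    constructor
    · obtain ⟨E, hE, -⟩ := exists_preferred_superset R ∅ (by simp [Admissible, ConflictFree])
      exact ⟨E, hE.1, h E hE⟩
    · intro S _ _ S' hS' _
      obtain ⟨E, hE, hSE⟩ := exists_preferred_superset R S' hS'
      exact ⟨E, hE.1, Set.union_subset hSE (Set.singleton_subset_iff.2 (h E hE))⟩
  · rintro ⟨⟨S, hS, haS⟩, h⟩ E hE
    by_cases hatt : SetAttacksSet R E S
    · obtain ⟨T, hT, hsub⟩ := h S hS haS E hE.1 hatt
      have hTE := hE.2 T hT (Set.subset_union_left.trans hsub)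
      exact hTE ▸ hsub (Or.inr rfl)
    · have hU : Admissible R (E ∪ S) := by
        refine ⟨?_, ?_⟩
        · rintro x (hx | hx) y (hy | hy) hxy
          · exact hE.1.1 x hx y hy hxy
          · exact hatt ⟨x, hx, y, hy, hxy⟩
          · obtain ⟨c, hc, hcx⟩ := hE.1.2 y hy x hxy
            exact hatt ⟨c, hc, x, hx, hcx⟩
          · exact hS.1 x hx y hy hxy
        · rintro x (hx | hx) y hyx
          · obtain ⟨c, hc, hcy⟩ := hE.1.2 x hx y hyx
            exact ⟨c, Or.inl hc, hcy⟩
          · obtain ⟨c, hc, hcy⟩ := hS.2 x hx y hyx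
            exact ⟨c, Or.inr hc, hcy⟩
      have hUE := hE.2 _ hU Set.subset_union_left
      exact hUE ▸ (Or.inr haS : a ∈ E ∪ S)
end

section
/- Let F = (A, R) be a finite abstract argumentation framework and let S ⊆ A be an admissible set. Then S is contained in every preferred extension of F if and only if for every argument a that attacks S (i.e., there is b ∈ S with (a,b) ∈ R) there exists no admissible set containing a. -/
/-- An admissible set `S` is contained in every preferred extension iff no attacker of `S`
belongs to any admissible set. -/
theorem admissible_subset_all_preferred_iff {A : Type*} [Fintype A]
    (R : A → A → Prop) (S : Set A) (hS : Admissible R S) :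
    (∀ E : Set A, Preferred R E → S ⊆ E) ↔
      (∀ a : A, (∃ b ∈ S, R a b) → ¬ ∃ T : Set A, Admissible R T ∧ a ∈ T) := by
  constructor
  · rintro h a ⟨b, hb, hab⟩ ⟨T, hT, haT⟩
    obtain ⟨E, hTE, hE⟩ := (Set.toFinite {X : Set A | Admissible R X}).exists_le_maximal hT
    have hEp : Preferred R E :=
      ⟨hE.prop, fun X hX hEX => Set.Subset.antisymm (hE.le_of_ge hX hEX) hEX⟩
    exact hE.prop.1 a (hTE haT) b (h E hEp hb) hab
  · intro h E hE
    have hES : ∀ a ∈ E, ∀ b ∈ S, ¬ R a b := fun a ha b hb hab =>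
      h a ⟨b, hb, hab⟩ ⟨E, hE.1, ha⟩
    have hadm : Admissible R (E ∪ S) := by
      refine ⟨?_, ?_⟩
      · rintro a (ha | ha) b (hb | hb) hab
        · exact hE.1.1 a ha b hb hab
        · exact hES a ha b hb hab
        · obtain ⟨c, hc, hca⟩ := hE.1.2 b hb a hab
          exact hES c hc a ha hca
        · exact hS.1 a ha b hb hab
      · rintro b (hb | hb) a hab
        · obtain ⟨c, hc, hca⟩ := hE.1.2 b hb a hab
          exact ⟨c, Or.inl hc, hca⟩
        · obtain ⟨c, hc, hca⟩ := hS.2 b hb a hab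
          exact ⟨c, Or.inr hc, hca⟩
    have heq := hE.2 _ hadm Set.subset_union_left
    intro x hx
    rw [← heq]
    exact Or.inr hx
end

section
/- Let F = (A, R) be a finite abstract argumentation framework and let X = { a ∈ A : no admissible set of F attacks a } be the set of arguments that are not attacked by any admissible set. Then a set S ⊆ A is the ideal extension of F (i.e., S is admissible, S is contained in every preferred extension, and S is maximal with respect to set inclusion among such sets) if and only if S is admissible, S ⊆ X, and S is maximal with respect to set inclusion among admissible subsets of X. -/
/-- `S` is the ideal extension iff `S` is admissible, contained in the set `X` of arguments
not attacked by any admissible set, and ⊆-maximal among admissible subsets of `X`. -/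
theorem ideal_iff_maximal_admissible_in_unattacked {A : Type*} [Fintype A]
    (R : A → A → Prop) (S : Set A)
    (X : Set A)
    (hX : X = {a : A | ¬ ∃ T : Set A, Admissible R T ∧ ∃ b ∈ T, R b a}) :
    (Admissible R S ∧ (∀ E : Set A, Preferred R E → S ⊆ E) ∧
        (∀ T : Set A, Admissible R T → (∀ E : Set A, Preferred R E → T ⊆ E) →
          S ⊆ T → T = S)) ↔
      (Admissible R S ∧ S ⊆ X ∧
        (∀ T : Set A, Admissible R T → T ⊆ X → S ⊆ T → T = S)) := by
  have key : ∀ T : Set A, Admissible R T →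
      ((∀ E : Set A, Preferred R E → T ⊆ E) ↔ T ⊆ X) := by
    intro T hT
    subst hX
    constructor
    · rintro h a ha ⟨U, hU, b, hb, hba⟩
      obtain ⟨E, hUE, hE⟩ :=
        (Set.toFinite {V : Set A | Admissible R V}).exists_le_maximal hU
      have hP : Preferred R E :=
        ⟨hE.prop, fun V hV hEV => Set.Subset.antisymm (hE.le_of_ge hV hEV) hEV⟩
      exact hP.1.1 b (hUE hb) a (h E hP ha) hba
    · intro h E hE
      have hadm : Admissible R (T ∪ E) := by
        constructor
        · rintro a (ha | ha) b (hb | hb) hab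
          · exact hT.1 a ha b hb hab
          · obtain ⟨c, hc, hca⟩ := hE.1.2 b hb a hab
            exact h ha ⟨E, hE.1, c, hc, hca⟩
          · exact h hb ⟨E, hE.1, a, ha, hab⟩
          · exact hE.1.1 a ha b hb hab
        · rintro a (ha | ha) b hab
          · obtain ⟨c, hc, hcb⟩ := hT.2 a ha b hab
            exact ⟨c, Or.inl hc, hcb⟩
          · obtain ⟨c, hc, hcb⟩ := hE.1.2 a ha b hab
            exact ⟨c, Or.inr hc, hcb⟩
      have heq := hE.2 _ hadm Set.subset_union_right
      exact Set.subset_union_left.trans heq.subset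
  constructor
  · rintro ⟨h1, h2, h3⟩
    exact ⟨h1, (key S h1).1 h2, fun T hT hTX => h3 T hT ((key T hT).2 hTX)⟩
  · rintro ⟨h1, h2, h3⟩
    exact ⟨h1, (key S h1).2 h2, fun T hT hTX => h3 T hT ((key T hT).1 hTX)⟩
end

section
/- Let F = (A, R) be a finite abstract argumentation framework. Then F has exactly one ideal extension: there exists a unique set E ⊆ A such that E is admissible, E is contained in every preferred extension of F, and E is maximal with respect to set inclusion among admissible sets contained in every preferred extension. -/
/-- Every finite abstract argumentation framework has exactly one ideal extension. -/
theorem ideal_extension_unique {A : Type*} [Fintype A] (R : A → A → Prop) :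
    ∃! E : Set A, Admissible R E ∧ (∀ P : Set A, Preferred R P → E ⊆ P) ∧
      (∀ S : Set A, Admissible R S → (∀ P : Set A, Preferred R P → S ⊆ P) →
        E ⊆ S → S = E) := by
  -- a preferred extension exists
  obtain ⟨P, hP⟩ : ∃ P : Set A, Preferred R P := by
    have hne : {S : Set A | Admissible R S}.Nonempty :=
      ⟨∅, fun a ha => ha.elim, fun a ha => ha.elim⟩
    obtain ⟨P, hP⟩ := (Set.toFinite {S : Set A | Admissible R S}).exists_maximal hne
    exact ⟨P, hP.1, fun S hS hPS => Set.Subset.antisymm (hP.2 hS hPS) hPS⟩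
  -- the union of all admissible sets contained in every preferred extension
  let U : Set A := {a | ∃ S : Set A, Admissible R S ∧
    (∀ P : Set A, Preferred R P → S ⊆ P) ∧ a ∈ S}
  have hsub : ∀ Q : Set A, Preferred R Q → U ⊆ Q := by
    rintro Q hQ a ⟨S, _, hS, ha⟩
    exact hS Q hQ ha
  have hadm : Admissible R U := by
    refine ⟨fun a ha b hb => hP.1.1 a (hsub P hP ha) b (hsub P hP hb), ?_⟩
    rintro a ⟨S, hS, hSP, ha⟩ b hb
    obtain ⟨c, hc, hcb⟩ := hS.2 a ha b hb
    exact ⟨c, ⟨S, hS, hSP, hc⟩, hcb⟩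
  have hmax : ∀ S : Set A, Admissible R S → (∀ P : Set A, Preferred R P → S ⊆ P) → S ⊆ U :=
    fun S hS hSP a ha => ⟨S, hS, hSP, ha⟩
  refine ⟨U, ⟨hadm, hsub, fun S hS hSP hUS => Set.Subset.antisymm (hmax S hS hSP) hUS⟩, ?_⟩
  rintro E ⟨hE, hEP, hEmax⟩
  exact (hEmax U hadm hsub (hmax E hE hEP)).symm
end

section
/- Let F = (A, R) be a finite abstract argumentation framework. Then F has exactly one grounded extension: there exists a unique set E ⊆ A that is a complete extension and minimal with respect to set inclusion among complete extensions. -/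
/-- A complete extension is an admissible set containing every argument it defends. -/
def Complete {A : Type*} (R : A → A → Prop) (E : Set A) : Prop :=
  Admissible R E ∧ ∀ a : A, Defends R E a → a ∈ E

/-- Every finite abstract argumentation framework has exactly one grounded extension,
i.e. a unique ⊆-minimal complete extension. -/
theorem grounded_extension_unique {A : Type*} [Fintype A] (R : A → A → Prop) :
    ∃! E : Set A, Complete R E ∧
      ∀ S : Set A, Complete R S → S ⊆ E → S = E := by
  have mono : ∀ (S T : Set A) (a : A), S ⊆ T → Defends R S a → Defends R T a := by
    intro S T a hST h b hb
    obtain ⟨c, hc, hcb⟩ := h b hb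
    exact ⟨c, hST hc, hcb⟩
  -- the least fixed point of the characteristic function
  let G : Set A := {x | ∀ S : Set A, (∀ a, Defends R S a → a ∈ S) → x ∈ S}
  have least : ∀ S : Set A, (∀ a, Defends R S a → a ∈ S) → G ⊆ S :=
    fun S hS x hx => hx S hS
  have closed : ∀ a, Defends R G a → a ∈ G :=
    fun a ha S hS => hS a (mono G S a (least S hS) ha)
  have post : ∀ a ∈ G, Defends R G a := by
    have h : G ⊆ {a | Defends R G a} :=
      least _ fun a ha => mono _ G a (fun x hx => closed x hx) ha
    exact fun a ha => h ha
  have cf : G ⊆ {x | x ∈ G ∧ ∀ b ∈ G, ¬ R b x} := by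
    apply least
    intro x hx
    refine ⟨closed x (mono _ G x (fun y hy => hy.1) hx), fun b hb hbx => ?_⟩
    obtain ⟨c, hc, hcb⟩ := hx b hbx
    obtain ⟨d, hd, hdc⟩ := post b hb c hcb
    exact hc.2 d hd hdc
  have hG : Complete R G := ⟨⟨fun a ha b hb => (cf hb).2 a ha, post⟩, closed⟩
  refine ⟨G, ⟨hG, fun S hS hSG => Set.Subset.antisymm hSG (least S hS.2)⟩, ?_⟩
  rintro E ⟨hE, hmin⟩
  exact (hmin G hG (least E hE.2)).symm
end
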